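/- If there is a collective strategy for the team that ensures, against every strategy of the opponent, that the play from the initial state never visits the set T with probability 1, then there is a deterministic memoryless collective strategy such that, for every opponent strategy, every play compatible with the resulting strategy profile (i.e., every infinite sequence of states in which each transition occurs with positive probability under the profile) avoids T. -/

import Mathlib

/-!
Common framework: team concurrent stochastic reachability games.
-/

noncomputable section

/-- A concurrent game structure: finitely many players, finitely many states,
finitely many actions per player, available actions, and a probabilistic
transition function. -/
structure GameStructure where
  Player : Type
  [playerFin : Fintype Player]
  [playerDec : DecidableEq Player]
  State : Type
  [stateFin : Fintype State]
  [stateDec : DecidableEq State]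
  Act : Player → Type
  [actFin : ∀ p, Fintype (Act p)]
  [actDec : ∀ p, DecidableEq (Act p)]
  Av : (p : Player) → State → Finset (Act p)
  av_nonempty : ∀ p s, (Av p s).Nonempty
  trans : State → ((p : Player) → Act p) → State → ℝ
  trans_nonneg : ∀ s a t, 0 ≤ trans s a t
  trans_sum : ∀ s a, ∑ t, trans s a t = 1

attribute [instance] GameStructure.playerFin GameStructure.playerDec
  GameStructure.stateFin GameStructure.stateDec GameStructure.actFin GameStructure.actDec

/-- A (behavioural) strategy of player `p`: a distribution over available
actions, for every history `h` (the list of previously visited states)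
and current state `s`. -/
structure Strategy (G : GameStructure) (p : G.Player) where
  toFun : List G.State → G.State → G.Act p → ℝ
  nonneg : ∀ h s a, 0 ≤ toFun h s a
  support_av : ∀ h s a, a ∉ G.Av p s → toFun h s a = 0
  sum_one : ∀ h s, ∑ a, toFun h s a = 1

/-- A strategy is memoryless if it only depends on the current state. -/
def Strategy.Memoryless {G : GameStructure} {p : G.Player} (σ : Strategy G p) : Prop :=
  ∀ h h' s, σ.toFun h s = σ.toFun h' s

/-- A strategy is deterministic if it always plays a single action with probability 1. -/
def Strategy.Deterministic {G : GameStructure} {p : G.Player} (σ : Strategy G p) : Prop :=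
  ∀ h s, ∃ a, σ.toFun h s a = 1

/-- A selector of player `p` at state `s`: a distribution over the available actions. -/
structure Selector (G : GameStructure) (p : G.Player) (s : G.State) where
  toFun : G.Act p → ℝ
  nonneg : ∀ a, 0 ≤ toFun a
  support_av : ∀ a, a ∉ G.Av p s → toFun a = 0
  sum_one : ∑ a, toFun a = 1

/-- A game: a game structure together with a team, an absorbing target set,
and an initial state. -/
structure Game extends GameStructure where
  team : Finset Player
  target : Finset State
  init : State
  absorbing : ∀ t ∈ target, ∀ a, trans t a t = 1

namespace Game

variable (Gm : Game)

abbrev TeamPlayer := {p : Gm.Player // p ∈ Gm.team}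
abbrev OppPlayer := {p : Gm.Player // p ∉ Gm.team}

/-- A collective strategy: one strategy for each team player. -/
abbrev TeamStrategy := (p : Gm.TeamPlayer) → Strategy Gm.toGameStructure p.1
/-- An opponent strategy: one strategy for each player outside the team. -/
abbrev OppStrategy := (p : Gm.OppPlayer) → Strategy Gm.toGameStructure p.1

abbrev TeamAct := (p : Gm.TeamPlayer) → Gm.Act p.1
abbrev OppAct := (p : Gm.OppPlayer) → Gm.Act p.1

/-- A collective selector at state `s`. -/
abbrev TeamSelector (s : Gm.State) := (p : Gm.TeamPlayer) → Selector Gm.toGameStructure p.1 s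

def MemorylessTeam (σ : Gm.TeamStrategy) : Prop := ∀ p, (σ p).Memoryless
def DeterministicTeam (σ : Gm.TeamStrategy) : Prop := ∀ p, (σ p).Deterministic
def MemorylessOpp (τ : Gm.OppStrategy) : Prop := ∀ p, (τ p).Memoryless

/-- Combine a collective strategy and an opponent strategy into a full profile. -/
def combine (σ : Gm.TeamStrategy) (τ : Gm.OppStrategy) (p : Gm.Player) :
    Strategy Gm.toGameStructure p :=
  if h : p ∈ Gm.team then σ ⟨p, h⟩ else τ ⟨p, h⟩

/-- Combine a joint team action and a joint opponent action into a full action profile. -/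
def combineAct (a : Gm.TeamAct) (b : Gm.OppAct) (p : Gm.Player) : Gm.Act p :=
  if h : p ∈ Gm.team then a ⟨p, h⟩ else b ⟨p, h⟩

/-- A joint opponent action is available at `s`. -/
def OppAvailable (s : Gm.State) (b : Gm.OppAct) : Prop := ∀ p, b p ∈ Gm.Av p.1 s

/-- One-step transition probability, under a full strategy profile, from state `s`
with history `h`, to state `t` (players randomise independently). -/
def stepProb (π : (p : Gm.Player) → Strategy Gm.toGameStructure p)
    (h : List Gm.State) (s t : Gm.State) : ℝ :=
  ∑ a : (p : Gm.Player) → Gm.Act p, (∏ p, (π p).toFun h s (a p)) * Gm.trans s a t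

/-- Probability of visiting the target within `n` steps, starting at state `s`
with history `h`. -/
def reachWithin (π : (p : Gm.Player) → Strategy Gm.toGameStructure p) :
    ℕ → List Gm.State → Gm.State → ℝ
  | 0, _, s => if s ∈ Gm.target then 1 else 0
  | n + 1, h, s =>
      if s ∈ Gm.target then 1
      else ∑ t, Gm.stepProb π h s t * reachWithin π n (h ++ [s]) t

/-- Probability of eventually reaching the target set, starting from state `s`. -/
def reachProbFrom (π : (p : Gm.Player) → Strategy Gm.toGameStructure p) (s : Gm.State) : ℝ :=
  ⨆ n : ℕ, Gm.reachWithin π n [] s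

/-- Probability of eventually reaching the target set from the initial state. -/
def reachProb (π : (p : Gm.Player) → Strategy Gm.toGameStructure p) : ℝ :=
  Gm.reachProbFrom π Gm.init

/-- Probability of visiting the target set for the first time exactly at step `k`. -/
def firstHit (π : (p : Gm.Player) → Strategy Gm.toGameStructure p) :
    ℕ → List Gm.State → Gm.State → ℝ
  | 0, _, s => if s ∈ Gm.target then 1 else 0
  | k + 1, h, s =>
      if s ∈ Gm.target then 0
      else ∑ t, Gm.stepProb π h s t * firstHit π k (h ++ [s]) t

/-- Expected `lam`-discounted payoff from the initial state: the play pays `lam ^ k`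
if it first visits the target at step `k`, and `0` if it never visits the target. -/
def discounted (π : (p : Gm.Player) → Strategy Gm.toGameStructure p) (lam : ℝ) : ℝ :=
  ∑' k : ℕ, lam ^ k * Gm.firstHit π k [] Gm.init

/-- A play (an infinite sequence of states from the initial state) is compatible with
a strategy profile if each of its transitions occurs with positive probability. -/
def CompatiblePlay (π : (p : Gm.Player) → Strategy Gm.toGameStructure p)
    (play : ℕ → Gm.State) : Prop :=
  play 0 = Gm.init ∧
  ∀ n, 0 < Gm.stepProb π (List.ofFn fun i : Fin n => play i.1) (play n) (play (n + 1))

/-- Expected value of the valuation `v` at the successor of `s`, when the team plays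
according to the collective selector `ξ` and the opponent plays the joint action `b`. -/
def preTeamAct (v : Gm.State → ℝ) (s : Gm.State) (ξ : Gm.TeamSelector s) (b : Gm.OppAct) : ℝ :=
  ∑ a : Gm.TeamAct, (∏ p, (ξ p).toFun (a p)) * ∑ t, Gm.trans s (Gm.combineAct a b) t * v t

/-- An opponent selector at state `s`: a distribution over available joint opponent actions. -/
structure OppSelector (s : Gm.State) where
  toFun : Gm.OppAct → ℝ
  nonneg : ∀ b, 0 ≤ toFun b
  support_av : ∀ b, ¬ Gm.OppAvailable s b → toFun b = 0
  sum_one : ∑ b, toFun b = 1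

/-- Expected value of `v` at the successor of `s` under a collective selector `ξ`
and an opponent selector `ζ`. -/
def preSel (v : Gm.State → ℝ) (s : Gm.State) (ξ : Gm.TeamSelector s) (ζ : Gm.OppSelector s) : ℝ :=
  ∑ b, ζ.toFun b * Gm.preTeamAct v s ξ b

/-- The predecessor operator: best one-step value the team can guarantee. -/
def pre (v : Gm.State → ℝ) (s : Gm.State) : ℝ :=
  ⨆ ξ : Gm.TeamSelector s, ⨅ ζ : Gm.OppSelector s, Gm.preSel v s ξ ζ

/-- The value iteration sequence: `vIter 0` is the indicator of the target set
and `vIter (n+1) = pre (vIter n)`. -/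
def vIter : ℕ → Gm.State → ℝ
  | 0 => fun s => if s ∈ Gm.target then 1 else 0
  | n + 1 => Gm.pre (vIter n)

/-- The max-min value of the game started at `s`. -/
def maxminFrom (s : Gm.State) : ℝ :=
  ⨆ σ : Gm.TeamStrategy, ⨅ τ : Gm.OppStrategy, Gm.reachProbFrom (Gm.combine σ τ) s

/-- The set of states from which the team can win almost surely. -/
def winSet : Set Gm.State :=
  {s | ∃ σ : Gm.TeamStrategy, ∀ τ : Gm.OppStrategy, Gm.reachProbFrom (Gm.combine σ τ) s = 1}

/-- Distribution of the successor of `s` when the team plays the collective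
selector `ξ` and the opponent plays the joint action `b`. -/
def succProbSel (s : Gm.State) (ξ : Gm.TeamSelector s) (b : Gm.OppAct) (t : Gm.State) : ℝ :=
  ∑ a : Gm.TeamAct, (∏ p, (ξ p).toFun (a p)) * Gm.trans s (Gm.combineAct a b) t

/-- Distribution of the successor of `s` (with history `h`) when the team plays the
collective strategy `σ` and the opponent plays the joint action `b`. -/
def succProbTeam (σ : Gm.TeamStrategy) (h : List Gm.State) (s : Gm.State)
    (b : Gm.OppAct) (t : Gm.State) : ℝ :=
  ∑ a : Gm.TeamAct, (∏ p, (σ p).toFun h s (a p)) * Gm.trans s (Gm.combineAct a b) t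

/-- The layered decomposition of the almost-sure winning set. -/
def wSeq : ℕ → Set Gm.State
  | 0 => ↑Gm.target
  | k + 1 =>
      wSeq k ∪
      {s ∈ Gm.winSet | ∃ ξ : Gm.TeamSelector s, ∀ b : Gm.OppAct, Gm.OppAvailable s b →
        (0 < ∑ t, (wSeq k).indicator (Gm.succProbSel s ξ b) t) ∧
        (∑ t, Gm.winSet.indicator (Gm.succProbSel s ξ b) t = 1)}

end Game

/-- The strategy that always plays uniformly over the available actions. -/
def Strategy.uniform (G : GameStructure) (p : G.Player) : Strategy G p where
  toFun _ s a := if a ∈ G.Av p s then ((G.Av p s).card : ℝ)⁻¹ else 0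
  nonneg h s a := by split_ifs <;> positivity
  support_av h s a ha := if_neg ha
  sum_one h s := by
    have hc : ((G.Av p s).card : ℝ) ≠ 0 :=
      Nat.cast_ne_zero.2 (Finset.card_ne_zero.2 (G.av_nonempty p s))
    simp [hc]

theorem Strategy.uniform_pos {G : GameStructure} {p : G.Player} (h : List G.State)
    {s : G.State} {a : G.Act p} (ha : a ∈ G.Av p s) :
    0 < (Strategy.uniform G p).toFun h s a := by
  have hc : (0 : ℝ) < (G.Av p s).card :=
    Nat.cast_pos.2 (Finset.card_pos.2 (G.av_nonempty p s))
  simpa [Strategy.uniform, ha] using hc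

theorem Strategy.exists_pos {G : GameStructure} {p : G.Player} (σ : Strategy G p)
    (h : List G.State) (s : G.State) : ∃ a, 0 < σ.toFun h s a := by
  by_contra! hle
  have := Finset.sum_nonpos fun a (_ : a ∈ Finset.univ) => hle a
  rw [σ.sum_one] at this
  linarith

theorem Strategy.mem_av_of_pos {G : GameStructure} {p : G.Player} (σ : Strategy G p)
    {h : List G.State} {s : G.State} {a : G.Act p} (ha : 0 < σ.toFun h s a) :
    a ∈ G.Av p s := by
  by_contra hn
  exact ha.ne' (σ.support_av h s a hn)

/-- The memoryless deterministic strategy playing the available action `f s` at `s`. -/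
def Strategy.pure {G : GameStructure} {p : G.Player} (f : G.State → G.Act p)
    (hf : ∀ s, f s ∈ G.Av p s) : Strategy G p where
  toFun _ s a := if a = f s then 1 else 0
  nonneg h s a := by split_ifs <;> norm_num
  support_av h s a ha := if_neg (by rintro rfl; exact ha (hf s))
  sum_one h s := by simp

namespace Game

variable {Gm : Game} (π : (p : Gm.Player) → Strategy Gm.toGameStructure p)

theorem stepProb_nonneg (h : List Gm.State) (s t : Gm.State) : 0 ≤ Gm.stepProb π h s t :=
  Finset.sum_nonneg fun a _ =>
    mul_nonneg (Finset.prod_nonneg fun p _ => (π p).nonneg h s (a p)) (Gm.trans_nonneg s a t)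

theorem sum_stepProb (h : List Gm.State) (s : Gm.State) : ∑ t, Gm.stepProb π h s t = 1 := by
  unfold stepProb
  rw [Finset.sum_comm]
  simp_rw [← Finset.mul_sum, Gm.trans_sum, mul_one]
  rw [← Fintype.prod_sum]
  simp [Strategy.sum_one]

theorem stepProb_pos_iff (h : List Gm.State) (s t : Gm.State) :
    0 < Gm.stepProb π h s t ↔
      ∃ a : (p : Gm.Player) → Gm.Act p,
        (∀ p, 0 < (π p).toFun h s (a p)) ∧ 0 < Gm.trans s a t := by
  have hprod (a : (p : Gm.Player) → Gm.Act p) : 0 ≤ ∏ p, (π p).toFun h s (a p) :=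
    Finset.prod_nonneg fun p _ => (π p).nonneg h s (a p)
  unfold stepProb
  rw [Finset.sum_pos_iff_of_nonneg fun a _ => mul_nonneg (hprod a) (Gm.trans_nonneg s a t)]
  refine ⟨?_, ?_⟩
  · rintro ⟨a, -, ha⟩
    refine ⟨a, fun p => ?_, pos_of_mul_pos_right ha (hprod a)⟩
    refine ((π p).nonneg h s (a p)).lt_of_ne' fun h0 => ha.ne' ?_
    rw [Finset.prod_eq_zero (Finset.mem_univ p) h0, zero_mul]
  · rintro ⟨a, ha, ht⟩
    exact ⟨a, Finset.mem_univ a, mul_pos (Finset.prod_pos fun p _ => ha p) ht⟩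

theorem reachWithin_nonneg (n : ℕ) (h : List Gm.State) (s : Gm.State) :
    0 ≤ Gm.reachWithin π n h s := by
  induction n generalizing h s with
  | zero => unfold reachWithin; split_ifs <;> norm_num
  | succ n ih =>
    unfold reachWithin
    split_ifs
    · norm_num
    · exact Finset.sum_nonneg fun t _ => mul_nonneg (stepProb_nonneg π h s t) (ih _ t)

theorem reachWithin_le_one (n : ℕ) (h : List Gm.State) (s : Gm.State) :
    Gm.reachWithin π n h s ≤ 1 := by
  induction n generalizing h s with
  | zero => unfold reachWithin; split_ifs <;> norm_num
  | succ n ih =>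
    unfold reachWithin
    split_ifs
    · exact le_rfl
    · rw [← sum_stepProb π h s]
      exact Finset.sum_le_sum fun t _ =>
        mul_le_of_le_one_right (stepProb_nonneg π h s t) (ih _ t)

/-- After history `h`, at state `s`, the profile `π` reaches the target with probability `0`. -/
def AlmostSurelySafe (h : List Gm.State) (s : Gm.State) : Prop :=
  ∀ n, Gm.reachWithin π n h s = 0

variable {π} {h : List Gm.State} {s : Gm.State}

theorem almostSurelySafe_init (h0 : Gm.reachProb π = 0) : AlmostSurelySafe π [] Gm.init := by
  intro n
  refine le_antisymm ?_ (reachWithin_nonneg π n _ _)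
  rw [← h0]
  exact le_ciSup (f := fun n => Gm.reachWithin π n [] Gm.init)
    ⟨1, by rintro _ ⟨m, rfl⟩; exact reachWithin_le_one π m _ _⟩ n

theorem AlmostSurelySafe.notMem_target (hs : AlmostSurelySafe π h s) : s ∉ Gm.target := by
  intro ht
  simpa [reachWithin, ht] using hs 0

theorem AlmostSurelySafe.step (hs : AlmostSurelySafe π h s) {t : Gm.State}
    (ht : 0 < Gm.stepProb π h s t) : AlmostSurelySafe π (h ++ [s]) t := by
  intro n
  have hsum := hs (n + 1)
  rw [reachWithin, if_neg hs.notMem_target, Finset.sum_eq_zero_iff_of_nonneg fun t _ =>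
    mul_nonneg (stepProb_nonneg π h s t) (reachWithin_nonneg π n _ t)] at hsum
  exact (mul_eq_zero.1 (hsum t (Finset.mem_univ t))).resolve_left ht.ne'

end Game

/-- If some collective strategy ensures, against every opponent
strategy, that the target set is never visited with probability 1, then some
deterministic memoryless collective strategy ensures that every play compatible
with the resulting profile avoids the target set. -/
theorem safe_almost_sure_implies_surely_safe (Gm : Game)
    (h : ∃ σ : Gm.TeamStrategy, ∀ τ : Gm.OppStrategy, Gm.reachProb (Gm.combine σ τ) = 0) :
    ∃ σ : Gm.TeamStrategy, Gm.MemorylessTeam σ ∧ Gm.DeterministicTeam σ ∧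
      ∀ τ : Gm.OppStrategy, ∀ play : ℕ → Gm.State,
        Gm.CompatiblePlay (Gm.combine σ τ) play → ∀ n, play n ∉ Gm.target := by
  classical
  obtain ⟨σ, hσ⟩ := h
  set π := Gm.combine σ fun p => Strategy.uniform Gm.toGameStructure p.1 with hπ
  have hex (s : Gm.State) : ∃ h : List Gm.State,
      (∃ h', Game.AlmostSurelySafe π h' s) → Game.AlmostSurelySafe π h s := by
    by_cases hs : ∃ h', Game.AlmostSurelySafe π h' s
    · exact hs.imp fun _ hh _ => hh
    · exact ⟨[], fun h' => absurd h' hs⟩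
  choose H hH using hex
  choose f hf using fun (p : Gm.TeamPlayer) (s : Gm.State) => (σ p).exists_pos (H s) s
  refine ⟨fun p => Strategy.pure (f p) fun s => (σ p).mem_av_of_pos (hf p s),
    fun p h h' s => rfl, fun p h s => ⟨f p s, if_pos rfl⟩, ?_⟩
  intro τ play hplay
  have hsafe (n : ℕ) : ∃ h, Game.AlmostSurelySafe π h (play n) := by
    induction n with
    | zero => exact ⟨[], hplay.1 ▸ Game.almostSurelySafe_init (hσ _)⟩
    | succ n ih =>
      refine ⟨_, (hH _ ih).step ?_⟩
      obtain ⟨a, ha, ht⟩ := (Game.stepProb_pos_iff _ _ _ _).1 (hplay.2 n)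
      refine (Game.stepProb_pos_iff _ _ _ _).2 ⟨a, fun p => ?_, ht⟩
      have hp := ha p
      by_cases hpt : p ∈ Gm.team
      · simp only [Game.combine, hpt, dite_true, Strategy.pure] at hp
        split_ifs at hp with he
        · simpa only [hπ, Game.combine, hpt, dite_true, he] using hf ⟨p, hpt⟩ (play n)
        · exact absurd hp (lt_irrefl _)
      · simp only [hπ, Game.combine, hpt, dite_false]
        exact Strategy.uniform_pos _ (Strategy.mem_av_of_pos _ hp)
  intro n
  exact (hsafe n).choose_spec.notMem_target
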